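/- Assume α, β, γ are positive irrational numbers with α + β + γ = 1, β < 1/2 and α < γ, and let W̃_α, W̃_β, W̃_γ be as defined in the context, with E_γ(n) = W̃_γ(n) − W_γ(n) the difference of counting functions. Then for every n ∈ ℕ, E_γ(n) ∈ {−1, 0, 1}; moreover E_γ(n) = 1 if 3/2 < u_n + v_n < 2 and (u_n < 1 − α or v_n < 1 − β/2); E_γ(n) = −1 if 0 < u_n + v_n < 1/2 and (u_n > α or v_n > β/2); and E_γ(n) = 0 otherwise. -/

import Mathlib

/-- The `n`-th term of the Webster sequence of density `d`: `⌈(n - 1/2)/d⌉`. -/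
noncomputable def wTerm (d : ℝ) (n : ℕ) : ℕ := ⌈((n : ℝ) - 1/2) / d⌉₊

/-- The Webster sequence of density `d`, as a set of positive integers. -/
def wSet (d : ℝ) : Set ℕ := {m : ℕ | ∃ n : ℕ, 1 ≤ n ∧ m = wTerm d n}

/-- Counting function of a set of positive integers: `S(m) = #{k ∈ S : k ≤ m}`. -/
noncomputable def wCount (S : Set ℕ) (m : ℕ) : ℕ := (S ∩ Set.Iic m).ncard

/-- `u_n = {nd + 1/2}` (fractional part), for density `d`. -/
noncomputable def fpart (d : ℝ) (n : ℕ) : ℝ := Int.fract ((n : ℝ) * d + 1/2)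

/-- The set `W̃_α` of Algorithm 2. -/
def WtA (α : ℝ) : Set ℕ := {n : ℕ | 1 ≤ n ∧ fpart α n < α}

/-- The set `W̃_β` of Algorithm 2. -/
def WtB (α β : ℝ) : Set ℕ := {n : ℕ | 1 ≤ n ∧
  ((α < fpart α n ∧ fpart β n < β) ∨
   (1 - α < fpart α n ∧ 1 - β/2 < fpart β n) ∨
   (α < fpart α n ∧ fpart α n < 2*α ∧ β < fpart β n ∧ fpart β n < 3*β/2))}

/-- The set `W̃_γ` of Algorithm 2. -/
def WtC (α β : ℝ) : Set ℕ := {n : ℕ | 1 ≤ n} \ (WtA α ∪ WtB α β)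

/-- `E_γ(n) = W̃_γ(n) − W_γ(n)`. -/
noncomputable def Egamma (α β γ : ℝ) (n : ℕ) : ℤ :=
  (wCount (WtC α β) n : ℤ) - (wCount (wSet γ) n : ℤ)

open Classical in
theorem wCount_succ (S : Set ℕ) (m : ℕ) :
    wCount S (m + 1) = wCount S m + if m + 1 ∈ S then 1 else 0 := by
  have hfin : (S ∩ Set.Iic m).Finite := (Set.finite_Iic m).subset Set.inter_subset_right
  unfold wCount
  split_ifs with h
  · have hset : S ∩ Set.Iic (m + 1) = insert (m + 1) (S ∩ Set.Iic m) := by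
      ext k
      simp only [Set.mem_inter_iff, Set.mem_Iic, Set.mem_insert_iff]
      constructor
      · rintro ⟨hk, hle⟩
        rcases Nat.lt_or_ge m k with hlt | hge
        · left; omega
        · exact Or.inr ⟨hk, hge⟩
      · rintro (rfl | ⟨hk, hle⟩)
        · exact ⟨h, le_rfl⟩
        · exact ⟨hk, by omega⟩
    rw [hset, Set.ncard_insert_of_notMem (by simp) hfin]
  · congr 1
    ext k
    simp only [Set.mem_inter_iff, Set.mem_Iic]
    constructor
    · rintro ⟨hk, hle⟩
      refine ⟨hk, ?_⟩
      rcases Nat.lt_or_ge m k with hlt | hge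
      · obtain rfl : k = m + 1 := by omega
        exact absurd hk h
      · exact hge
    · rintro ⟨hk, hle⟩
      exact ⟨hk, by omega⟩

theorem wTerm_le_iff {d : ℝ} (hd : 0 < d) (n m : ℕ) :
    wTerm d n ≤ m ↔ n ≤ ⌊(m : ℝ) * d + 1/2⌋₊ := by
  rw [wTerm, Nat.ceil_le, div_le_iff₀ hd, Nat.le_floor_iff (by positivity)]
  constructor <;> intro h <;> linarith

theorem wTerm_strictMonoOn {d : ℝ} (hd : 0 < d) (hd1 : d < 1) :
    StrictMonoOn (wTerm d) (Set.Ici 1) := by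
  intro a ha b _ hab
  rw [Set.mem_Ici] at ha
  have ha' : (1 : ℝ) ≤ a := by exact_mod_cast ha
  have hab' : (a : ℝ) + 1 ≤ b := by exact_mod_cast hab
  have hpos : (0 : ℝ) ≤ ((a : ℝ) - 1/2) / d := div_nonneg (by linarith) hd.le
  have hgap : ((a : ℝ) - 1/2) / d + 1 < ((b : ℝ) - 1/2) / d := by
    rw [div_add_one hd.ne']
    exact div_lt_div_of_pos_right (by linarith) hd
  exact Nat.lt_ceil.2 ((Nat.ceil_lt_add_one hpos).trans hgap)

/-- The Webster sequence of density `d` has `⌊md + 1/2⌋` terms up to `m`. -/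
theorem wCount_wSet {d : ℝ} (hd : 0 < d) (hd1 : d < 1) (m : ℕ) :
    wCount (wSet d) m = ⌊(m : ℝ) * d + 1/2⌋₊ := by
  have hset : wSet d ∩ Set.Iic m
      = wTerm d '' (Finset.Icc 1 ⌊(m : ℝ) * d + 1/2⌋₊ : Finset ℕ) := by
    ext k
    simp only [wSet, Set.mem_inter_iff, Set.mem_ofPred_eq, Set.mem_Iic, Set.mem_image,
      Finset.coe_Icc, Set.mem_Icc]
    constructor
    · rintro ⟨⟨n, hn, rfl⟩, hle⟩
      exact ⟨n, ⟨hn, (wTerm_le_iff hd n m).1 hle⟩, rfl⟩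
    · rintro ⟨n, ⟨hn, hle⟩, rfl⟩
      exact ⟨⟨n, hn, rfl⟩, (wTerm_le_iff hd n m).2 hle⟩
  have hinj : Set.InjOn (wTerm d) (Finset.Icc 1 ⌊(m : ℝ) * d + 1/2⌋₊ : Finset ℕ) :=
    (wTerm_strictMonoOn hd hd1).injOn.mono fun k hk => (Finset.mem_Icc.1 hk).1
  rw [wCount, hset, hinj.ncard_image, Set.ncard_coe_finset, Nat.card_Icc]
  rfl

theorem fpart_ne {d : ℝ} (hd : Irrational d) (n : ℕ) (q : ℚ) (r : ℤ) :
    fpart d n ≠ q * d + r := by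
  intro h
  rw [fpart, Int.fract] at h
  generalize ⌊(n : ℝ) * d + 1/2⌋ = k at h
  by_cases hq : (n : ℚ) = q
  · have hq' : (n : ℝ) = q := by exact_mod_cast hq
    rw [hq'] at h
    have h2 : (1 : ℝ) = 2 * (k + r) := by linarith
    have h3 : (1 : ℤ) = 2 * (k + r) := by exact_mod_cast h2
    omega
  · have hne : (n : ℝ) - q ≠ 0 := by
      rw [sub_ne_zero]
      exact_mod_cast hq
    refine hd ⟨(k + r - 1/2) / (n - q), ?_⟩
    push_cast
    rw [div_eq_iff hne]
    linarith

theorem fpart_nonneg (d : ℝ) (n : ℕ) : 0 ≤ fpart d n := Int.fract_nonneg _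

theorem fpart_lt_one (d : ℝ) (n : ℕ) : fpart d n < 1 := Int.fract_lt_one _

theorem floor_add_fpart (d : ℝ) (n : ℕ) :
    (⌊(n : ℝ) * d + 1/2⌋ : ℝ) + fpart d n = (n : ℝ) * d + 1/2 := Int.floor_add_fract _

/-- One step of the rotation `n ↦ fpart d n`, together with the integer part. -/
theorem fpart_succ {d : ℝ} (hd : 0 < d) (hd1 : d < 1) (n : ℕ) :
    (fpart d (n + 1) < d ∧ fpart d n = fpart d (n + 1) + 1 - d ∧
      ⌊((n + 1 : ℕ) : ℝ) * d + 1/2⌋ = ⌊(n : ℝ) * d + 1/2⌋ + 1) ∨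
    (d ≤ fpart d (n + 1) ∧ fpart d n = fpart d (n + 1) - d ∧
      ⌊((n + 1 : ℕ) : ℝ) * d + 1/2⌋ = ⌊(n : ℝ) * d + 1/2⌋) := by
  have e0 := floor_add_fpart d n
  have e1 := floor_add_fpart d (n + 1)
  have a0 := fpart_nonneg d n
  have a1 := fpart_lt_one d n
  have b0 := fpart_nonneg d (n + 1)
  have b1 := fpart_lt_one d (n + 1)
  generalize ⌊(n : ℝ) * d + 1/2⌋ = j at *
  generalize ⌊((n + 1 : ℕ) : ℝ) * d + 1/2⌋ = k at *
  push_cast at e1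
  have h1 : (k : ℝ) < j + 2 := by linarith
  have h2 : (j : ℝ) < k + 1 := by linarith
  have h1' : k < j + 2 := by exact_mod_cast h1
  have h2' : j < k + 1 := by exact_mod_cast h2
  obtain rfl | rfl : k = j + 1 ∨ k = j := by omega
  · left
    push_cast at e1
    exact ⟨by linarith, by linarith, rfl⟩
  · right
    exact ⟨by linarith, by linarith, rfl⟩

open Classical in
/-- The difference between the counting functions of `WtB` and of the Webster sequence of
density `β`, in terms of `u = u_n` and `v = v_n`. -/
noncomputable def betaError (α β u v : ℝ) : ℤ :=
  if 1 - α < u ∧ 1 - β/2 < v then 1 else if u < α ∧ v < β/2 then -1 else 0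

set_option maxHeartbeats 2000000 in
theorem wCount_WtC (α β : ℝ) (hα : 0 < α) (hβ : 0 < β)
    (hαi : Irrational α) (hβi : Irrational β) (hα2 : α < 1/2) (hβ2 : β < 1/2) (n : ℕ) :
    (wCount (WtC α β) n : ℤ) = n - ⌊(n : ℝ) * α + 1/2⌋ - ⌊(n : ℝ) * β + 1/2⌋
      - betaError α β (fpart α n) (fpart β n) := by
  induction n with
  | zero =>
    have h0 : wCount (WtC α β) 0 = 0 := by
      rw [wCount, Set.ncard_eq_zero ((Set.finite_Iic 0).subset Set.inter_subset_right)]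
      ext k
      simp only [WtC, Set.mem_inter_iff, Set.mem_sdiff, Set.mem_ofPred_eq, Set.mem_Iic,
        Set.mem_empty_iff_false, iff_false, not_and]
      intro hk
      omega
    have hf : ∀ d : ℝ, fpart d 0 = 1/2 := fun d => by
      rw [fpart, Int.fract_eq_iff]
      exact ⟨by norm_num, by norm_num, 0, by simp⟩
    have hfl : ⌊(1/2 : ℝ)⌋ = 0 := by rw [Int.floor_eq_iff]; norm_num
    rw [h0, hf, hf, betaError, if_neg (fun h => by linarith [h.1]),
      if_neg (fun h => by linarith [h.1])]
    simp only [Nat.cast_zero, zero_mul, zero_add, hfl]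
    norm_num
  | succ n ih =>
    classical
    rw [wCount_succ, Nat.cast_add, ih]
    have u1 : fpart α (n + 1) ≠ α := by simpa using fpart_ne hαi (n + 1) 1 0
    have v1 : fpart β (n + 1) ≠ β := by simpa using fpart_ne hβi (n + 1) 1 0
    have v2 : fpart β (n + 1) ≠ β/2 := by
      have := fpart_ne hβi (n + 1) (1/2) 0
      push_cast at this
      intro h
      exact this (by linarith)
    have u0 : 0 < fpart α (n + 1) := (fpart_nonneg α (n + 1)).lt_of_ne'
      (by simpa using fpart_ne hαi (n + 1) 0 0)
    have u3 := fpart_lt_one α (n + 1)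
    have v0 : 0 < fpart β (n + 1) := (fpart_nonneg β (n + 1)).lt_of_ne'
      (by simpa using fpart_ne hβi (n + 1) 0 0)
    have v3 := fpart_lt_one β (n + 1)
    have hC : n + 1 ∈ WtC α β ↔ ¬ fpart α (n + 1) < α ∧
        ¬ ((α < fpart α (n + 1) ∧ fpart β (n + 1) < β) ∨
          (1 - α < fpart α (n + 1) ∧ 1 - β/2 < fpart β (n + 1)) ∨
          (α < fpart α (n + 1) ∧ fpart α (n + 1) < 2*α ∧
            β < fpart β (n + 1) ∧ fpart β (n + 1) < 3*β/2)) := by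
      simp [WtC, WtA, WtB]
    rw [if_congr hC rfl rfl]
    have hu := fpart_succ hα (by linarith) n
    have hv := fpart_succ hβ (by linarith) n
    generalize fpart α (n + 1) = u at *
    generalize fpart β (n + 1) = v at *
    generalize fpart α n = u' at *
    generalize fpart β n = v' at *
    unfold betaError
    rcases hu with ⟨hu1, rfl, hu3⟩ | ⟨hu1, rfl, hu3⟩ <;>
      rcases hv with ⟨hv1, rfl, hv3⟩ | ⟨hv1, rfl, hv3⟩ <;>
      rw [hu3, hv3] <;> clear ih hC hu3 hv3 hαi hβi <;>
      replace u1 := lt_or_gt_of_ne u1 <;> replace v1 := lt_or_gt_of_ne v1 <;>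
      replace v2 := lt_or_gt_of_ne v2 <;>
      split_ifs <;> first | (push_cast; ring1) | (exfalso; grind)

/-- Characterization of the counting-function error `E_γ(n)`. -/
theorem Egamma_characterization (α β γ : ℝ)
    (hα : 0 < α) (hβ : 0 < β) (hγ : 0 < γ)
    (hαi : Irrational α) (hβi : Irrational β) (hγi : Irrational γ)
    (hsum : α + β + γ = 1) (hβhalf : β < 1/2) (hαγ : α < γ) :
    ∀ n : ℕ, 1 ≤ n →
      (Egamma α β γ n = -1 ∨ Egamma α β γ n = 0 ∨ Egamma α β γ n = 1) ∧
      ((3/2 < fpart α n + fpart β n ∧ fpart α n + fpart β n < 2 ∧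
          (fpart α n < 1 - α ∨ fpart β n < 1 - β/2)) → Egamma α β γ n = 1) ∧
      ((0 < fpart α n + fpart β n ∧ fpart α n + fpart β n < 1/2 ∧
          (α < fpart α n ∨ β/2 < fpart β n)) → Egamma α β γ n = -1) ∧
      (¬(3/2 < fpart α n + fpart β n ∧ fpart α n + fpart β n < 2 ∧
          (fpart α n < 1 - α ∨ fpart β n < 1 - β/2)) →
        ¬(0 < fpart α n + fpart β n ∧ fpart α n + fpart β n < 1/2 ∧
          (α < fpart α n ∨ β/2 < fpart β n)) → Egamma α β γ n = 0) := by
  intro n hn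
  have hn0 : (n : ℝ) ≠ 0 := by
    have : n ≠ 0 := by omega
    exact_mod_cast this
  have eα := floor_add_fpart α n
  have eβ := floor_add_fpart β n
  have u0 := fpart_nonneg α n
  have u1 := fpart_lt_one α n
  have v0 := fpart_nonneg β n
  have v1 := fpart_lt_one β n
  have u2 : fpart α n ≠ 0 := by simpa using fpart_ne hαi n 0 0
  have u3 : fpart α n ≠ 1 - α := by
    have := fpart_ne hαi n (-1) 1
    push_cast at this
    intro h
    exact this (by linarith)
  have v3 : fpart β n ≠ 1 - β/2 := by
    have := fpart_ne hβi n (-1/2) 1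
    push_cast at this
    intro h
    exact this (by linarith)
  have u4 : fpart α n ≠ α := by simpa using fpart_ne hαi n 1 0
  have v4 : fpart β n ≠ β/2 := by
    have := fpart_ne hβi n (1/2) 0
    push_cast at this
    intro h
    exact this (by linarith)
  have hγsum : (n : ℝ) * γ = n - n * α - n * β := by
    rw [show γ = 1 - α - β by linarith]; ring
  have hhalf : fpart α n + fpart β n ≠ 1/2 := by
    intro h
    refine hγi ⟨(n + 1/2 - ⌊(n : ℝ) * α + 1/2⌋ - ⌊(n : ℝ) * β + 1/2⌋) / n, ?_⟩
    push_cast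
    rw [div_eq_iff hn0]
    linarith
  have hE : Egamma α β γ n = n - ⌊(n : ℝ) * α + 1/2⌋ - ⌊(n : ℝ) * β + 1/2⌋
      - betaError α β (fpart α n) (fpart β n) - ⌊(n : ℝ) * γ + 1/2⌋ := by
    rw [Egamma, wCount_WtC α β hα hβ hαi hβi (by linarith) hβhalf,
      wCount_wSet hγ (by linarith), Int.natCast_floor_eq_floor (by positivity)]
  have hfl : (fpart α n + fpart β n < 1/2 ∧
        ⌊(n : ℝ) * γ + 1/2⌋ = n - ⌊(n : ℝ) * α + 1/2⌋ - ⌊(n : ℝ) * β + 1/2⌋ + 1) ∨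
      (1/2 < fpart α n + fpart β n ∧ fpart α n + fpart β n ≤ 3/2 ∧
        ⌊(n : ℝ) * γ + 1/2⌋ = n - ⌊(n : ℝ) * α + 1/2⌋ - ⌊(n : ℝ) * β + 1/2⌋) ∨
      (3/2 < fpart α n + fpart β n ∧
        ⌊(n : ℝ) * γ + 1/2⌋ = n - ⌊(n : ℝ) * α + 1/2⌋ - ⌊(n : ℝ) * β + 1/2⌋ - 1) := by
    rcases lt_or_gt_of_ne hhalf with h | h
    · left
      refine ⟨h, ?_⟩
      rw [Int.floor_eq_iff]
      push_cast
      constructor <;> linarith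
    · right
      rcases le_or_gt (fpart α n + fpart β n) (3/2) with h' | h'
      · left
        refine ⟨h, h', ?_⟩
        rw [Int.floor_eq_iff]
        push_cast
        constructor <;> linarith
      · right
        refine ⟨h', ?_⟩
        rw [Int.floor_eq_iff]
        push_cast
        constructor <;> linarith
  rw [hE]
  clear hE eα eβ hγsum
  generalize fpart α n = u at *
  generalize fpart β n = v at *
  have u2 : 0 < u := lt_of_le_of_ne u0 (Ne.symm u2)
  unfold betaError
  rcases hfl with ⟨h, hfl⟩ | ⟨h, h', hfl⟩ | ⟨h, hfl⟩ <;> rw [hfl] <;>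
    split_ifs <;> grind
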